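/- arXiv:2410.09810 — 6 statements merged into one kernel-verified Lean document; each statement's English description precedes it below -/
import Mathlib

section
/- (Alignment of left and right singular-subspace projections.) In the truncated SVD setup, let σ_d(A) > 0 denote the smallest diagonal entry of D_A. Then ‖ U_Pᵀ U_A − V_Pᵀ V_A ‖_F ≤ d ( ‖ U_Pᵀ (A − P) V_A ‖_F + ‖ V_Pᵀ (A − P)ᵀ U_A ‖_F ) / σ_d(A). -/
open Matrix

noncomputable section

/-- Frobenius norm of a real matrix. -/
def frobNorm {ι κ : Type*} [Fintype ι] [Fintype κ] (M : Matrix ι κ ℝ) : ℝ :=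
  Real.sqrt (∑ i, ∑ j, M i j ^ 2)

theorem frobNorm_eq_norm {ι κ : Type*} [Fintype ι] [Fintype κ] (M : Matrix ι κ ℝ) :
    frobNorm M = ‖WithLp.toLp 2 (fun q : ι × κ => M q.1 q.2)‖ := by
  simp [frobNorm, EuclideanSpace.norm_eq, Fintype.sum_prod_type]

theorem frobNorm_nonneg {ι κ : Type*} [Fintype ι] [Fintype κ] (M : Matrix ι κ ℝ) :
    0 ≤ frobNorm M :=
  Real.sqrt_nonneg _

theorem frobNorm_sub_le {ι κ : Type*} [Fintype ι] [Fintype κ] (M N : Matrix ι κ ℝ) :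
    frobNorm (M - N) ≤ frobNorm M + frobNorm N := by
  simp only [frobNorm_eq_norm]
  exact norm_sub_le (WithLp.toLp 2 fun q : ι × κ => M q.1 q.2)
    (WithLp.toLp 2 fun q : ι × κ => N q.1 q.2)

theorem mul_frobNorm_le {ι κ : Type*} [Fintype ι] [Fintype κ] {c : ℝ} (hc : 0 ≤ c)
    {M N : Matrix ι κ ℝ} (h : ∀ i j, c * |M i j| ≤ |N i j|) :
    c * frobNorm M ≤ frobNorm N := by
  rw [frobNorm, frobNorm, ← Real.sqrt_sq hc, ← Real.sqrt_mul (sq_nonneg c)]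
  refine Real.sqrt_le_sqrt ?_
  simp only [Finset.mul_sum]
  refine Finset.sum_le_sum fun i _ => Finset.sum_le_sum fun j _ => ?_
  rw [← sq_abs (M i j), ← sq_abs (N i j), ← mul_pow]
  exact pow_le_pow_left₀ (by positivity) (h i j) 2

/-- A lower bound for the Sylvester operator `Z ↦ Z * diagonal f + diagonal g * Z`. -/
theorem mul_frobNorm_le_frobNorm_sylvester {ι κ : Type*} [Fintype ι] [Fintype κ]
    [DecidableEq ι] [DecidableEq κ] {f : κ → ℝ} {g : ι → ℝ} {c : ℝ} (hc : 0 ≤ c)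
    (hf : ∀ j, c ≤ f j) (hg : ∀ i, 0 ≤ g i) (Z : Matrix ι κ ℝ) :
    c * frobNorm Z ≤ frobNorm (Z * diagonal f + diagonal g * Z) := by
  refine mul_frobNorm_le hc fun i j => ?_
  have hcfg : c ≤ f j + g i := by linarith [hf j, hg i]
  have hentry : (Z * diagonal f + diagonal g * Z) i j = (f j + g i) * Z i j := by
    simp only [Matrix.add_apply, mul_diagonal, diagonal_mul]
    ring
  rw [hentry, abs_mul, abs_of_nonneg (hc.trans hcfg)]
  exact mul_le_mul_of_nonneg_right hcfg (abs_nonneg _)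

/-- **Alignment of left and right singular-subspace projections.**
In the truncated SVD setup, with `σ_d(A)` the smallest diagonal entry of `Dₐ`,
`‖U_Pᵀ Uₐ − V_Pᵀ Vₐ‖_F ≤ d (‖U_Pᵀ (A − P) Vₐ‖_F + ‖V_Pᵀ (A − P)ᵀ Uₐ‖_F) / σ_d(A)`. -/
theorem alignment_left_right_subspaces {d m p : ℕ}
    (A P : Matrix (Fin m) (Fin p) ℝ)
    (DA DP : Matrix (Fin d) (Fin d) ℝ)
    (UA UP : Matrix (Fin m) (Fin d) ℝ)
    (VA VP : Matrix (Fin p) (Fin d) ℝ)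
    (hDA : ∃ f : Fin d → ℝ, (∀ i, 0 < f i) ∧ DA = Matrix.diagonal f)
    (hDP : ∃ g : Fin d → ℝ, (∀ i, 0 < g i) ∧ DP = Matrix.diagonal g)
    (hUA : UAᵀ * UA = 1) (hVA : VAᵀ * VA = 1)
    (hAVA : A * VA = UA * DA) (hAUA : Aᵀ * UA = VA * DA)
    (hUP : UPᵀ * UP = 1) (hVP : VPᵀ * VP = 1)
    (hP : P = UP * DP * VPᵀ) :
    frobNorm (UPᵀ * UA - VPᵀ * VA) ≤
      d * (frobNorm (UPᵀ * (A - P) * VA) + frobNorm (VPᵀ * (A - P)ᵀ * UA)) /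
        (⨅ i, DA i i) := by
  obtain ⟨f, hf, rfl⟩ := hDA
  obtain ⟨g, hg, rfl⟩ := hDP
  simp only [diagonal_apply_eq]
  rcases Nat.eq_zero_or_pos d with rfl | hd
  · simp [frobNorm]
  have : Nonempty (Fin d) := ⟨⟨0, hd⟩⟩
  obtain ⟨k, hk⟩ := exists_eq_ciInf_of_finite (f := f)
  have hσ : 0 < ⨅ i, f i := hk ▸ hf k
  have hle : ∀ j, (⨅ i, f i) ≤ f j := ciInf_le (Set.finite_range f).bddBelow
  have hleft : UPᵀ * (A - P) * VA
      = UPᵀ * UA * diagonal f - diagonal g * (VPᵀ * VA) := by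
    have hUPP : UPᵀ * P = diagonal g * VPᵀ := by
      rw [hP, ← Matrix.mul_assoc, ← Matrix.mul_assoc, hUP, Matrix.one_mul]
    rw [Matrix.mul_sub, Matrix.sub_mul, hUPP, Matrix.mul_assoc, hAVA]
    simp only [Matrix.mul_assoc]
  have hright : VPᵀ * (A - P)ᵀ * UA
      = VPᵀ * VA * diagonal f - diagonal g * (UPᵀ * UA) := by
    have hVPP : VPᵀ * Pᵀ = diagonal g * UPᵀ := by
      rw [hP, transpose_mul, transpose_mul, transpose_transpose, diagonal_transpose,
        ← Matrix.mul_assoc, hVP, Matrix.one_mul]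
    rw [transpose_sub, Matrix.mul_sub, Matrix.sub_mul, hVPP, Matrix.mul_assoc, hAUA]
    simp only [Matrix.mul_assoc]
  have hsylv : (UPᵀ * UA - VPᵀ * VA) * diagonal f + diagonal g * (UPᵀ * UA - VPᵀ * VA)
      = UPᵀ * (A - P) * VA - VPᵀ * (A - P)ᵀ * UA := by
    rw [hleft, hright, Matrix.sub_mul, Matrix.mul_sub]
    abel
  have hbound := mul_frobNorm_le_frobNorm_sylvester hσ.le hle (fun i => (hg i).le)
    (UPᵀ * UA - VPᵀ * VA)
  rw [hsylv] at hbound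
  rw [le_div_iff₀' hσ]
  refine (hbound.trans (frobNorm_sub_le _ _)).trans (le_mul_of_one_le_left ?_ ?_)
  · exact add_nonneg (frobNorm_nonneg _) (frobNorm_nonneg _)
  · exact_mod_cast hd
end
end

section
/- (Polar factor approximates the product of singular-vector matrices.) Let d, m ∈ ℕ with d ≤ m, and let U, Ũ ∈ ℝ^{m×d} each have orthonormal columns. Let B = Uᵀ Ũ, let B = W₁ Σ W₂ᵀ be a singular value decomposition (W₁, W₂ ∈ O(d), Σ diagonal nonnegative), and set W_U = W₁ W₂ᵀ. Then ‖ B − W_U ‖_F ≤ d · ‖ Ũ Ũᵀ − U Uᵀ ‖², where ‖·‖ is the spectral norm. -/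
open Matrix

noncomputable section

/-- Euclidean norm of a finitely-indexed real vector. -/
def vecNorm {ι : Type*} [Fintype ι] (v : ι → ℝ) : ℝ :=
  Real.sqrt (∑ i, v i ^ 2)

/-- Spectral norm (operator norm with respect to Euclidean norms) of a real matrix. -/
def specNorm {ι κ : Type*} [Fintype ι] [Fintype κ] (M : Matrix ι κ ℝ) : ℝ :=
  sSup {c | ∃ v : κ → ℝ, vecNorm v ≤ 1 ∧ c = vecNorm (M.mulVec v)}

lemma vecNorm_sq {ι : Type*} [Fintype ι] (v : ι → ℝ) : vecNorm v ^ 2 = ∑ i, v i ^ 2 :=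
  Real.sq_sqrt (Finset.sum_nonneg fun _ _ => sq_nonneg _)

/-- The Frobenius norm bounds the action of a matrix on the Euclidean unit ball. -/
lemma vecNorm_mulVec_le_frobNorm {ι κ : Type*} [Fintype ι] [Fintype κ] (M : Matrix ι κ ℝ)
    {v : κ → ℝ} (hv : vecNorm v ≤ 1) : vecNorm (M.mulVec v) ≤ frobNorm M := by
  have hv' : ∑ j, v j ^ 2 ≤ 1 := by
    rw [← vecNorm_sq]
    exact pow_le_one₀ (Real.sqrt_nonneg _) hv
  refine Real.sqrt_le_sqrt (Finset.sum_le_sum fun i _ => ?_)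
  calc (M.mulVec v) i ^ 2 ≤ (∑ j, M i j ^ 2) * ∑ j, v j ^ 2 :=
        Finset.sum_mul_sq_le_sq_mul_sq _ _ _
    _ ≤ ∑ j, M i j ^ 2 :=
        mul_le_of_le_one_right (Finset.sum_nonneg fun _ _ => sq_nonneg _) hv'

lemma vecNorm_mulVec_le_specNorm {ι κ : Type*} [Fintype ι] [Fintype κ] (M : Matrix ι κ ℝ)
    {v : κ → ℝ} (hv : vecNorm v ≤ 1) : vecNorm (M.mulVec v) ≤ specNorm M := by
  refine le_csSup ⟨frobNorm M, ?_⟩ ⟨v, hv, rfl⟩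
  rintro _ ⟨w, hw, rfl⟩
  exact vecNorm_mulVec_le_frobNorm M hw

lemma vecNorm_col_sq {ι κ : Type*} [Fintype ι] (M : Matrix ι κ ℝ) (j : κ) :
    vecNorm (M.col j) ^ 2 = (Mᵀ * M) j j := by
  rw [vecNorm_sq]
  simp [Matrix.mul_apply, sq]

lemma frobNorm_eq_sqrt_trace {ι κ : Type*} [Fintype ι] [Fintype κ] (M : Matrix ι κ ℝ) :
    frobNorm M = Real.sqrt (Mᵀ * M).trace := by
  rw [frobNorm, Finset.sum_comm]
  simp [Matrix.trace, Matrix.mul_apply, sq]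

/-- If `Uᵀ * V` has orthogonal columns of squared lengths `s i ^ 2`, where `U` and `V` have
orthonormal columns and `P` acts on `V` as `1 - U * Uᵀ`, then `1 - s i ^ 2` is nonnegative and at
most the squared spectral norm of `P`. -/
lemma one_sub_sq_le_specNorm_sq {m d : ℕ} {P : Matrix (Fin m) (Fin m) ℝ}
    {U V : Matrix (Fin m) (Fin d) ℝ} (hU : Uᵀ * U = 1) (hV : Vᵀ * V = 1)
    (hP : P * V = V - U * (Uᵀ * V)) {s : Fin d → ℝ}
    (hs : (Uᵀ * V)ᵀ * (Uᵀ * V) = Matrix.diagonal fun i => s i ^ 2) (i : Fin d) :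
    0 ≤ 1 - s i ^ 2 ∧ 1 - s i ^ 2 ≤ specNorm P ^ 2 := by
  have hgram : (P * V)ᵀ * (P * V) = 1 - Matrix.diagonal fun i => s i ^ 2 := by
    have h₁ : Vᵀ * (U * (Uᵀ * V)) = (Uᵀ * V)ᵀ * (Uᵀ * V) := by
      simp [Matrix.mul_assoc]
    have h₂ : (U * (Uᵀ * V))ᵀ * V = (Uᵀ * V)ᵀ * (Uᵀ * V) := by
      simp [Matrix.mul_assoc]
    have h₃ : (U * (Uᵀ * V))ᵀ * (U * (Uᵀ * V)) = (Uᵀ * V)ᵀ * (Uᵀ * V) := by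
      rw [Matrix.transpose_mul, Matrix.mul_assoc, ← Matrix.mul_assoc Uᵀ U, hU, Matrix.one_mul]
    rw [hP, Matrix.transpose_sub, Matrix.sub_mul, Matrix.mul_sub, Matrix.mul_sub, h₁, h₂, h₃, hV,
      hs]
    abel
  have hcol : vecNorm (P.mulVec (V.col i)) ^ 2 = 1 - s i ^ 2 := by
    have : P.mulVec (V.col i) = (P * V).col i := rfl
    rw [this, vecNorm_col_sq, hgram]
    simp
  have hunit : vecNorm (V.col i) ≤ 1 := by
    have : vecNorm (V.col i) ^ 2 = 1 := by rw [vecNorm_col_sq, hV, Matrix.one_apply_eq]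
    nlinarith
  rw [← hcol]
  exact ⟨sq_nonneg _, pow_le_pow_left₀ (Real.sqrt_nonneg _) (vecNorm_mulVec_le_specNorm P hunit) 2⟩

/-- **Polar factor approximates the product of singular-vector matrices.**
If `U, Ũ ∈ ℝ^{m×d}` have orthonormal columns, `B = Uᵀ Ũ = W₁ Σ W₂ᵀ` is an SVD and
`W_U = W₁ W₂ᵀ`, then `‖B − W_U‖_F ≤ d ‖Ũ Ũᵀ − U Uᵀ‖²`. -/
theorem polar_factor_close_to_cross_product {d m : ℕ} (hdm : d ≤ m)
    (U Ut : Matrix (Fin m) (Fin d) ℝ)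
    (hU : Uᵀ * U = 1) (hUt : Utᵀ * Ut = 1)
    (W₁ W₂ S : Matrix (Fin d) (Fin d) ℝ)
    (hW₁ : W₁ᵀ * W₁ = 1) (hW₂ : W₂ᵀ * W₂ = 1)
    (hS : ∃ s : Fin d → ℝ, (∀ i, 0 ≤ s i) ∧ S = Matrix.diagonal s)
    (hSVD : Uᵀ * Ut = W₁ * S * W₂ᵀ) :
    frobNorm (Uᵀ * Ut - W₁ * W₂ᵀ) ≤ d * specNorm (Ut * Utᵀ - U * Uᵀ) ^ 2 := by
  obtain ⟨s, hs, rfl⟩ := hS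
  have hUV : Uᵀ * (Ut * W₂) = W₁ * Matrix.diagonal s := by
    rw [← Matrix.mul_assoc, hSVD, Matrix.mul_assoc, hW₂, Matrix.mul_one]
  have hV : (Ut * W₂)ᵀ * (Ut * W₂) = 1 := by
    rw [Matrix.transpose_mul, Matrix.mul_assoc, ← Matrix.mul_assoc Utᵀ, hUt, Matrix.one_mul, hW₂]
  have hP : (Ut * Utᵀ - U * Uᵀ) * (Ut * W₂) = Ut * W₂ - U * (Uᵀ * (Ut * W₂)) := by
    rw [Matrix.sub_mul, Matrix.mul_assoc, ← Matrix.mul_assoc Utᵀ, hUt, Matrix.one_mul,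
      Matrix.mul_assoc]
  have hgram : (Uᵀ * (Ut * W₂))ᵀ * (Uᵀ * (Ut * W₂)) = Matrix.diagonal fun i => s i ^ 2 := by
    rw [hUV, Matrix.transpose_mul, Matrix.mul_assoc, ← Matrix.mul_assoc W₁ᵀ, hW₁, Matrix.one_mul,
      Matrix.diagonal_transpose, Matrix.diagonal_mul_diagonal]
    simp only [sq]
  have hgap := one_sub_sq_le_specNorm_sq hU hV hP hgram
  set δ := specNorm (Ut * Utᵀ - U * Uᵀ)
  have hdiff : Uᵀ * Ut - W₁ * W₂ᵀ = W₁ * (Matrix.diagonal (fun i => s i - 1) * W₂ᵀ) := by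
    have : Matrix.diagonal (fun i => s i - 1) = Matrix.diagonal s - 1 := by
      rw [← Matrix.diagonal_one, Matrix.diagonal_sub]
    rw [this, hSVD, Matrix.sub_mul, Matrix.mul_sub, Matrix.one_mul, Matrix.mul_assoc]
  have htrace : ((Uᵀ * Ut - W₁ * W₂ᵀ)ᵀ * (Uᵀ * Ut - W₁ * W₂ᵀ)).trace = ∑ i, (s i - 1) ^ 2 := by
    rw [hdiff, Matrix.transpose_mul, Matrix.mul_assoc, ← Matrix.mul_assoc W₁ᵀ, hW₁, Matrix.one_mul,
      Matrix.transpose_mul, Matrix.transpose_transpose, Matrix.mul_assoc, Matrix.trace_mul_comm,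
      Matrix.mul_assoc, Matrix.mul_assoc, hW₂, Matrix.mul_one, Matrix.diagonal_transpose,
      Matrix.diagonal_mul_diagonal, Matrix.trace_diagonal]
    simp only [sq]
  rw [frobNorm_eq_sqrt_trace, htrace]
  refine Real.sqrt_le_iff.mpr ⟨by positivity, ?_⟩
  calc ∑ i, (s i - 1) ^ 2 ≤ ∑ _i : Fin d, (δ ^ 2) ^ 2 := by
        refine Finset.sum_le_sum fun i _ => sq_le_sq.mpr ?_
        have hle : s i ≤ 1 := by nlinarith [hgap i, hs i]
        rw [abs_of_nonpos (by linarith), abs_of_nonneg (sq_nonneg δ)]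
        nlinarith [hgap i, hs i]
    _ = d * (δ ^ 2) ^ 2 := by simp
    _ ≤ (d : ℝ) ^ 2 * (δ ^ 2) ^ 2 := by
        gcongr
        exact_mod_cast Nat.le_self_pow two_ne_zero d
    _ = (d * δ ^ 2) ^ 2 := by ring
end
end

section
/- (Commutator-type bounds for square roots and inverse square roots of diagonal matrices.) Let d ∈ ℕ, let D_A = diag(a₁,…,a_d) and D_P = diag(p₁,…,p_d) with a_j > 0 and p_j ≥ 0 for all j, and set a_min = min_j a_j, p_min = min_j p_j. Then for every W ∈ ℝ^{d×d}: (i) ‖ W D_A^{1/2} − D_P^{1/2} W ‖_F ≤ ‖ W D_A − D_P W ‖_F / ( a_min^{1/2} + p_min^{1/2} ); and (ii) if additionally p_j > 0 for all j, ‖ W D_A^{−1/2} − D_P^{−1/2} W ‖_F ≤ ‖ W D_A^{1/2} − D_P^{1/2} W ‖_F / ( a_min^{1/2} p_min^{1/2} ). -/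
open Matrix

noncomputable section

/-- Entrywise domination by a positive factor passes to Frobenius norms. -/
theorem frobNorm_le_div_of_forall_mul_abs_le {ι κ : Type*} [Fintype ι] [Fintype κ]
    {M N : Matrix ι κ ℝ} {c : ℝ} (hc : 0 < c) (h : ∀ i j, c * |M i j| ≤ |N i j|) :
    frobNorm M ≤ frobNorm N / c := by
  rw [le_div_iff₀ hc, frobNorm, frobNorm]
  refine Real.le_sqrt_of_sq_le ?_
  rw [mul_pow, Real.sq_sqrt (by positivity), Finset.sum_mul]
  refine Finset.sum_le_sum fun i _ => ?_
  rw [Finset.sum_mul]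
  refine Finset.sum_le_sum fun j _ => ?_
  rw [← mul_pow, sq_le_sq, abs_mul, abs_of_pos hc, mul_comm]
  exact h i j

/-- **Commutator-type bounds for square roots and inverse square roots of diagonal matrices.**
For `D_A = diag a` with positive entries and `D_P = diag p` with nonnegative entries and any
`W`: (i) `‖W D_A^{1/2} − D_P^{1/2} W‖_F ≤ ‖W D_A − D_P W‖_F / (√a_min + √p_min)`;
(ii) if moreover all `p j > 0`,
`‖W D_A^{−1/2} − D_P^{−1/2} W‖_F ≤ ‖W D_A^{1/2} − D_P^{1/2} W‖_F / (√a_min √p_min)`. -/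
theorem diagonal_sqrt_commutator_bounds {d : ℕ}
    (a p : Fin d → ℝ) (ha : ∀ j, 0 < a j) (hp : ∀ j, 0 ≤ p j)
    (W : Matrix (Fin d) (Fin d) ℝ) :
    frobNorm (W * Matrix.diagonal (fun j => Real.sqrt (a j)) -
        Matrix.diagonal (fun j => Real.sqrt (p j)) * W) ≤
      frobNorm (W * Matrix.diagonal a - Matrix.diagonal p * W) /
        (Real.sqrt (⨅ j, a j) + Real.sqrt (⨅ j, p j)) ∧
    ((∀ j, 0 < p j) →
      frobNorm (W * Matrix.diagonal (fun j => (Real.sqrt (a j))⁻¹) -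
          Matrix.diagonal (fun j => (Real.sqrt (p j))⁻¹) * W) ≤
        frobNorm (W * Matrix.diagonal (fun j => Real.sqrt (a j)) -
            Matrix.diagonal (fun j => Real.sqrt (p j)) * W) /
          (Real.sqrt (⨅ j, a j) * Real.sqrt (⨅ j, p j))) := by
  rcases isEmpty_or_nonempty (Fin d) with hd | hd
  · simp [frobNorm]
  have iInf_le_apply (f : Fin d → ℝ) (j : Fin d) : (⨅ j, f j) ≤ f j :=
    ciInf_le (Set.finite_range f).bddBelow j
  have sqrt_iInf_pos {f : Fin d → ℝ} (hf : ∀ j, 0 < f j) : 0 < √(⨅ j, f j) := by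
    obtain ⟨j, hj⟩ := exists_eq_ciInf_of_finite (f := f)
    exact Real.sqrt_pos.2 (hj ▸ hf j)
  refine ⟨frobNorm_le_div_of_forall_mul_abs_le
    (add_pos_of_pos_of_nonneg (sqrt_iInf_pos ha) (Real.sqrt_nonneg _)) fun i j => ?_,
    fun hp' => frobNorm_le_div_of_forall_mul_abs_le
      (mul_pos (sqrt_iInf_pos ha) (sqrt_iInf_pos hp')) fun i j => ?_⟩
  · simp only [Matrix.sub_apply, Matrix.mul_diagonal, Matrix.diagonal_mul]
    have factor : W i j * a j - p i * W i j =
        (√(a j) + √(p i)) * (W i j * √(a j) - √(p i) * W i j) := by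
      linear_combination -W i j * Real.sq_sqrt (ha j).le + W i j * Real.sq_sqrt (hp i)
    rw [factor, abs_mul, abs_of_nonneg (add_nonneg (Real.sqrt_nonneg _) (Real.sqrt_nonneg _))]
    gcongr
    · exact iInf_le_apply a j
    · exact iInf_le_apply p i
  · simp only [Matrix.sub_apply, Matrix.mul_diagonal, Matrix.diagonal_mul]
    have haj := Real.sqrt_pos.2 (ha j)
    have hpi := Real.sqrt_pos.2 (hp' i)
    have factor : W i j * √(a j) - √(p i) * W i j =
        -(√(a j) * √(p i)) * (W i j * (√(a j))⁻¹ - (√(p i))⁻¹ * W i j) := by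
      field_simp
      ring
    rw [factor, abs_mul, abs_neg, abs_of_pos (mul_pos haj hpi)]
    gcongr
    · exact iInf_le_apply a j
    · exact iInf_le_apply p i
end
end

section
/- (Existence of aligning invertible transformations.) Let d, m, p ∈ ℕ with d ≤ min(m,p), let X ∈ ℝ^{m×d} and Y ∈ ℝ^{p×d} both have rank d, and set P = X Yᵀ. Let P = U_P D_P V_Pᵀ be a rank-d singular value decomposition, where U_P ∈ ℝ^{m×d} and V_P ∈ ℝ^{p×d} have orthonormal columns and D_P ∈ ℝ^{d×d} is diagonal with positive diagonal entries, and define X_P = U_P D_P^{1/2} and Y_P = V_P D_P^{1/2}. Then there exist invertible matrices L̃, R̃ ∈ ℝ^{d×d} such that X_P = X L̃, Y_P = Y R̃, and L̃ R̃ᵀ = I_d. -/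
open Matrix

noncomputable section

/-- Entrywise square root of (the diagonal of) a diagonal matrix. -/
def dsqrt {d : ℕ} (D : Matrix (Fin d) (Fin d) ℝ) : Matrix (Fin d) (Fin d) ℝ :=
  Matrix.diagonal fun i => Real.sqrt (D i i)

/-- A real matrix of full column rank has a left inverse. -/
theorem exists_left_inverse_of_rank_eq {m d : ℕ} (X : Matrix (Fin m) (Fin d) ℝ)
    (hX : X.rank = d) : ∃ A : Matrix (Fin d) (Fin m) ℝ, A * X = 1 := by
  have hrank : (Xᵀ * X).rank = d := by rw [rank_transpose_mul_self, hX]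
  have hli : LinearIndependent ℝ (Xᵀ * X).col := by
    rw [linearIndependent_iff_card_eq_finrank_span, Set.finrank, ← rank_eq_finrank_span_cols,
      hrank, Fintype.card_fin]
  have hdet : IsUnit (Xᵀ * X).det :=
    (isUnit_iff_isUnit_det _).1 (linearIndependent_cols_iff_isUnit.1 hli)
  exact ⟨(Xᵀ * X)⁻¹ * Xᵀ, by rw [Matrix.mul_assoc, nonsing_inv_mul _ hdet]⟩

/-- For a positive diagonal matrix `D`, `dsqrt D` squares to `D` and has a right inverse. -/
theorem dsqrt_mul_self_and_exists_right_inverse {d : ℕ} {f : Fin d → ℝ} (hf : ∀ i, 0 < f i) :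
    dsqrt (diagonal f) * dsqrt (diagonal f) = diagonal f ∧
      ∃ T, dsqrt (diagonal f) * T = 1 := by
  refine ⟨?_, diagonal fun i => (Real.sqrt (f i))⁻¹, ?_⟩
  · simp [dsqrt, fun i => Real.mul_self_sqrt (hf i).le]
  · simp [dsqrt, fun i => mul_inv_cancel₀ (Real.sqrt_pos.2 (hf i)).ne']

/-- **Existence of aligning invertible transformations.**
If `X ∈ ℝ^{m×d}` and `Y ∈ ℝ^{p×d}` have rank `d`, `P = X Yᵀ = U_P D_P V_Pᵀ` is a rank-`d` SVD,
`X_P = U_P D_P^{1/2}` and `Y_P = V_P D_P^{1/2}`, then there are invertible `L̃, R̃ ∈ ℝ^{d×d}`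
with `X_P = X L̃`, `Y_P = Y R̃` and `L̃ R̃ᵀ = I`. -/
theorem exists_aligning_transformations {d m p : ℕ} (hdm : d ≤ m) (hdp : d ≤ p)
    (X : Matrix (Fin m) (Fin d) ℝ) (Y : Matrix (Fin p) (Fin d) ℝ)
    (hX : X.rank = d) (hY : Y.rank = d)
    (UP : Matrix (Fin m) (Fin d) ℝ) (VP : Matrix (Fin p) (Fin d) ℝ)
    (DP : Matrix (Fin d) (Fin d) ℝ)
    (hDP : ∃ f : Fin d → ℝ, (∀ i, 0 < f i) ∧ DP = Matrix.diagonal f)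
    (hUP : UPᵀ * UP = 1) (hVP : VPᵀ * VP = 1)
    (hSVD : X * Yᵀ = UP * DP * VPᵀ) :
    ∃ L R : Matrix (Fin d) (Fin d) ℝ, IsUnit L.det ∧ IsUnit R.det ∧
      UP * dsqrt DP = X * L ∧ VP * dsqrt DP = Y * R ∧ L * Rᵀ = 1 := by
  obtain ⟨f, hf, rfl⟩ := hDP
  obtain ⟨hS, T, hT⟩ := dsqrt_mul_self_and_exists_right_inverse hf
  obtain ⟨A, hA⟩ := exists_left_inverse_of_rank_eq X hX
  obtain ⟨B, hB⟩ := exists_left_inverse_of_rank_eq Y hY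
  have hSt : (dsqrt (diagonal f))ᵀ = dsqrt (diagonal f) := diagonal_transpose _
  have hSVDt : Y * Xᵀ = VP * diagonal f * UPᵀ := by
    simpa [Matrix.mul_assoc] using congrArg transpose hSVD
  have hDT : diagonal f * T = dsqrt (diagonal f) := by
    calc diagonal f * T = dsqrt (diagonal f) * dsqrt (diagonal f) * T := by rw [hS]
      _ = dsqrt (diagonal f) := by rw [Matrix.mul_assoc, hT, Matrix.mul_one]
  have hL : UP * dsqrt (diagonal f) = X * (Yᵀ * VP * T) := by
    calc UP * dsqrt (diagonal f) = UP * diagonal f * (VPᵀ * VP) * T := by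
          rw [hVP, Matrix.mul_one, Matrix.mul_assoc, hDT]
      _ = X * Yᵀ * VP * T := by rw [hSVD]; simp only [Matrix.mul_assoc]
      _ = X * (Yᵀ * VP * T) := by simp only [Matrix.mul_assoc]
  have hR : VP * dsqrt (diagonal f) = Y * (Xᵀ * UP * T) := by
    calc VP * dsqrt (diagonal f) = VP * diagonal f * (UPᵀ * UP) * T := by
          rw [hUP, Matrix.mul_one, Matrix.mul_assoc, hDT]
      _ = Y * Xᵀ * UP * T := by rw [hSVDt]; simp only [Matrix.mul_assoc]
      _ = Y * (Xᵀ * UP * T) := by simp only [Matrix.mul_assoc]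
  generalize Yᵀ * VP * T = L at hL
  generalize Xᵀ * UP * T = R at hR
  have hBt : Yᵀ * Bᵀ = 1 := by rw [← transpose_mul, hB, transpose_one]
  have hLR : L * Rᵀ = 1 := by
    calc L * Rᵀ = A * X * (L * Rᵀ) * (Yᵀ * Bᵀ) := by rw [hA, hBt, Matrix.one_mul, Matrix.mul_one]
      _ = A * ((X * L) * (Y * R)ᵀ) * Bᵀ := by rw [transpose_mul]; simp only [Matrix.mul_assoc]
      _ = A * (UP * (dsqrt (diagonal f) * dsqrt (diagonal f)) * VPᵀ) * Bᵀ := by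
          rw [← hL, ← hR, transpose_mul, hSt]; simp only [Matrix.mul_assoc]
      _ = A * (X * Yᵀ) * Bᵀ := by rw [hS, hSVD]
      _ = A * X * (Yᵀ * Bᵀ) := by simp only [Matrix.mul_assoc]
      _ = 1 := by rw [hA, hBt, Matrix.mul_one]
  refine ⟨L, R, isUnit_det_of_right_inverse hLR, ?_, hL, hR, hLR⟩
  rw [← det_transpose]
  exact isUnit_det_of_left_inverse hLR
end
end

section
/- (Identities for the aligning transformations.) Let d, m, p ∈ ℕ with d ≤ min(m,p), let X ∈ ℝ^{m×d} and Y ∈ ℝ^{p×d} both have rank d, set P = X Yᵀ, let P = U_P D_P V_Pᵀ be a rank-d singular value decomposition (U_P ∈ ℝ^{m×d}, V_P ∈ ℝ^{p×d} with orthonormal columns, D_P ∈ ℝ^{d×d} diagonal with positive diagonal entries), and define X_P = U_P D_P^{1/2}, Y_P = V_P D_P^{1/2}. Then any invertible matrices L̃, R̃ ∈ ℝ^{d×d} satisfying X_P = X L̃, Y_P = Y R̃ and L̃ R̃ᵀ = I_d also satisfy R̃ D_P^{−1} L̃^{−1} = (Yᵀ Y)^{−1} and L̃ D_P^{−1} R̃^{−1}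 = (Xᵀ X)^{−1}. -/
open Matrix

noncomputable section

/-- The Gram matrix of `V D^{1/2}` is `D` when `V` has orthonormal columns. -/
lemma transpose_mul_self_mul_dsqrt {d n : ℕ} {V : Matrix (Fin n) (Fin d) ℝ}
    {f : Fin d → ℝ} (hf : ∀ i, 0 ≤ f i) (hV : Vᵀ * V = 1) :
    (V * dsqrt (diagonal f))ᵀ * (V * dsqrt (diagonal f)) = diagonal f := by
  rw [transpose_mul, Matrix.mul_assoc, ← Matrix.mul_assoc Vᵀ, hV, Matrix.one_mul]
  simp [dsqrt, Real.mul_self_sqrt (hf _)]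

/-- If `R` is invertible and `Y R` has Gram matrix `D`, then `R D⁻¹ Rᵀ` is the inverse of the
Gram matrix of `Y`. -/
lemma mul_inv_mul_transpose_eq_gram_inv {d n : ℕ} {Y : Matrix (Fin n) (Fin d) ℝ}
    {R D : Matrix (Fin d) (Fin d) ℝ} (hR : IsUnit R.det) (h : (Y * R)ᵀ * (Y * R) = D) :
    R * D⁻¹ * Rᵀ = (Yᵀ * Y)⁻¹ := by
  have hD : D = Rᵀ * ((Yᵀ * Y) * R) := by
    rw [← h, transpose_mul]
    simp only [Matrix.mul_assoc]
  have hRt : IsUnit Rᵀ.det := by rwa [det_transpose]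
  rw [hD, Matrix.mul_inv_rev, Matrix.mul_inv_rev (Yᵀ * Y), Matrix.mul_assoc,
    Matrix.nonsing_inv_mul_cancel_right _ _ hRt, Matrix.mul_nonsing_inv_cancel_left _ _ hR]

/-- **Identities for the aligning transformations.**
With `X, Y` of rank `d`, `P = X Yᵀ = U_P D_P V_Pᵀ` a rank-`d` SVD,
`X_P = U_P D_P^{1/2}`, `Y_P = V_P D_P^{1/2}`, any invertible `L̃, R̃` with
`X_P = X L̃`, `Y_P = Y R̃`, `L̃ R̃ᵀ = I` satisfy `R̃ D_P⁻¹ L̃⁻¹ = (YᵀY)⁻¹` and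
`L̃ D_P⁻¹ R̃⁻¹ = (XᵀX)⁻¹`. -/
theorem aligning_transformations_identities {d m p : ℕ} (hdm : d ≤ m) (hdp : d ≤ p)
    (X : Matrix (Fin m) (Fin d) ℝ) (Y : Matrix (Fin p) (Fin d) ℝ)
    (hX : X.rank = d) (hY : Y.rank = d)
    (UP : Matrix (Fin m) (Fin d) ℝ) (VP : Matrix (Fin p) (Fin d) ℝ)
    (DP : Matrix (Fin d) (Fin d) ℝ)
    (hDP : ∃ f : Fin d → ℝ, (∀ i, 0 < f i) ∧ DP = Matrix.diagonal f)
    (hUP : UPᵀ * UP = 1) (hVP : VPᵀ * VP = 1)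
    (hSVD : X * Yᵀ = UP * DP * VPᵀ)
    (L R : Matrix (Fin d) (Fin d) ℝ)
    (hL : IsUnit L.det) (hR : IsUnit R.det)
    (hXL : UP * dsqrt DP = X * L) (hYR : VP * dsqrt DP = Y * R)
    (hLR : L * Rᵀ = 1) :
    R * DP⁻¹ * L⁻¹ = (Yᵀ * Y)⁻¹ ∧ L * DP⁻¹ * R⁻¹ = (Xᵀ * X)⁻¹ := by
  obtain ⟨f, hf, rfl⟩ := hDP
  have hf' : ∀ i, 0 ≤ f i := fun i => (hf i).le
  have hRL : R * Lᵀ = 1 := by simpa using congrArg transpose hLR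
  rw [Matrix.inv_eq_right_inv hLR, Matrix.inv_eq_right_inv hRL]
  exact ⟨mul_inv_mul_transpose_eq_gram_inv hR (hYR ▸ transpose_mul_self_mul_dsqrt hf' hVP),
    mul_inv_mul_transpose_eq_gram_inv hL (hXL ▸ transpose_mul_self_mul_dsqrt hf' hUP)⟩
end
end

section
/- (Exact decomposition of the left spectral embedding error.) In the truncated SVD setup, for every matrix W ∈ ℝ^{d×d} the following exact identity holds: U_A D_A^{1/2} − U_P D_P^{1/2} W = (A − P) V_P D_P^{−1/2} W + R₁ + R₂ + R₃ + R₄, where R₁ = U_P ( U_Pᵀ U_A D_A^{1/2} − D_P^{1/2} W ), R₂ = (I − U_P U_Pᵀ)(A − P)(V_A − V_P W) D_A^{−1/2}, R₃ = − U_P U_Pᵀ (A − P) V_P W D_A^{−1/2}, and R₄ = (A − P) V_P ( W D_A^{−1/2} − D_P^{−1/2} W ). -/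
open Matrix

noncomputable section

/-- Entrywise inverse square root of (the diagonal of) a diagonal matrix. -/
def dinvsqrt {d : ℕ} (D : Matrix (Fin d) (Fin d) ℝ) : Matrix (Fin d) (Fin d) ℝ :=
  Matrix.diagonal fun i => (Real.sqrt (D i i))⁻¹

theorem diagonal_mul_dinvsqrt {d : ℕ} (f : Fin d → ℝ) :
    Matrix.diagonal f * dinvsqrt (Matrix.diagonal f) = dsqrt (Matrix.diagonal f) := by
  simp only [dsqrt, dinvsqrt, Matrix.diagonal_mul_diagonal, Matrix.diagonal_apply_eq,
    ← div_eq_mul_inv, Real.div_sqrt]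

/-- **Exact decomposition of the left spectral embedding error.**
In the truncated SVD setup, for every `W ∈ ℝ^{d×d}`,
`Uₐ Dₐ^{1/2} − U_P D_P^{1/2} W = (A − P) V_P D_P^{−1/2} W + R₁ + R₂ + R₃ + R₄`. -/
theorem left_embedding_error_decomposition {d m p : ℕ}
    (A P : Matrix (Fin m) (Fin p) ℝ)
    (DA DP : Matrix (Fin d) (Fin d) ℝ)
    (UA UP : Matrix (Fin m) (Fin d) ℝ)
    (VA VP : Matrix (Fin p) (Fin d) ℝ)
    (hDA : ∃ f : Fin d → ℝ, (∀ i, 0 < f i) ∧ DA = Matrix.diagonal f)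
    (hDP : ∃ g : Fin d → ℝ, (∀ i, 0 < g i) ∧ DP = Matrix.diagonal g)
    (hUA : UAᵀ * UA = 1) (hVA : VAᵀ * VA = 1)
    (hAVA : A * VA = UA * DA) (hAUA : Aᵀ * UA = VA * DA)
    (hUP : UPᵀ * UP = 1) (hVP : VPᵀ * VP = 1)
    (hP : P = UP * DP * VPᵀ)
    (W : Matrix (Fin d) (Fin d) ℝ) :
    UA * dsqrt DA - UP * dsqrt DP * W =
      (A - P) * VP * dinvsqrt DP * W
        + UP * (UPᵀ * UA * dsqrt DA - dsqrt DP * W)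
        + (1 - UP * UPᵀ) * (A - P) * (VA - VP * W) * dinvsqrt DA
        + (-(UP * UPᵀ * (A - P) * VP * W * dinvsqrt DA))
        + (A - P) * VP * (W * dinvsqrt DA - dinvsqrt DP * W) := by
  obtain ⟨f, -, rfl⟩ := hDA
  have hsqrt := diagonal_mul_dinvsqrt f
  have hUPP : (1 - UP * UPᵀ) * P = 0 := by
    rw [hP, Matrix.sub_mul, Matrix.one_mul, Matrix.mul_assoc UP DP, Matrix.mul_assoc UP UPᵀ,
      ← Matrix.mul_assoc UPᵀ UP, hUP, Matrix.one_mul, sub_self]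
  have hVA_term : (1 - UP * UPᵀ) * (A - P) * VA * dinvsqrt (Matrix.diagonal f) =
      (1 - UP * UPᵀ) * UA * dsqrt (Matrix.diagonal f) := by
    rw [Matrix.mul_sub, hUPP, sub_zero, Matrix.mul_assoc _ A VA, hAVA, ← hsqrt]
    simp only [Matrix.mul_assoc]
  rw [Matrix.mul_sub _ VA, Matrix.sub_mul _ _ (dinvsqrt (Matrix.diagonal f)), hVA_term]
  generalize A - P = E
  simp only [Matrix.sub_mul, Matrix.mul_sub, Matrix.one_mul, Matrix.mul_assoc]
  abel
end
end
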